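/- arXiv:chao-dyn/9609015 — 7 statements merged into one kernel-verified Lean document; each statement's English description precedes it below -/
import Mathlib

section
/- Let E be a real vector space of dimension m ≥ 3 and let ω be a nondegenerate alternating 3-form on E. Choose e₁, e₂, e₃ ∈ E with ω(e₁, e₂, e₃) = 1 and let P₁ = span{e₁, e₂, e₃}. Then E decomposes as the direct sum E = P₁ ⊕ P₁^⊥, where P₁^⊥ is the Nambu complement of P₁. -/
open Module

noncomputable section

/-- The Nambu complement of a subspace `P` with respect to an alternating 3-form `ω`:
`P^⊥ = {z : ω(z, z₁, z₂) = 0 for all z₁, z₂ ∈ P}`. -/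
def nambuComplement {E : Type*} [AddCommGroup E] [Module ℝ E]
    (ω : E [⋀^Fin 3]→ₗ[ℝ] ℝ) (P : Submodule ℝ E) : Submodule ℝ E where
  carrier := {z : E | ∀ z₁ ∈ P, ∀ z₂ ∈ P, ω ![z, z₁, z₂] = 0}
  zero_mem' := by
    intro z₁ _ z₂ _
    show ω.curryLeft 0 ![z₁, z₂] = 0
    rw [map_zero]; rfl
  add_mem' := by
    intro x y hx hy z₁ h₁ z₂ h₂
    show ω.curryLeft (x + y) ![z₁, z₂] = 0
    rw [map_add]
    have hx' := hx z₁ h₁ z₂ h₂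
    have hy' := hy z₁ h₁ z₂ h₂
    show ω.curryLeft x ![z₁, z₂] + ω.curryLeft y ![z₁, z₂] = 0
    rw [show ω.curryLeft x ![z₁, z₂] = ω ![x, z₁, z₂] from rfl,
      show ω.curryLeft y ![z₁, z₂] = ω ![y, z₁, z₂] from rfl, hx', hy', add_zero]
  smul_mem' := by
    intro c x hx z₁ h₁ z₂ h₂
    show ω.curryLeft (c • x) ![z₁, z₂] = 0
    rw [map_smul]
    have hx' := hx z₁ h₁ z₂ h₂
    show c • (ω.curryLeft x ![z₁, z₂]) = 0
    rw [show ω.curryLeft x ![z₁, z₂] = ω ![x, z₁, z₂] from rfl, hx', smul_zero]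

theorem aux_add {E : Type*} [AddCommGroup E] [Module ℝ E]
    (ω : E [⋀^Fin 3]→ₗ[ℝ] ℝ) (x y a b : E) :
    ω ![x + y, a, b] = ω ![x, a, b] + ω ![y, a, b] := by
  show ω.curryLeft (x + y) ![a, b] = _
  rw [map_add]; rfl

theorem aux_smul {E : Type*} [AddCommGroup E] [Module ℝ E]
    (ω : E [⋀^Fin 3]→ₗ[ℝ] ℝ) (c : ℝ) (x a b : E) :
    ω ![c • x, a, b] = c * ω ![x, a, b] := by
  show ω.curryLeft (c • x) ![a, b] = _
  rw [map_smul]; rfl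

theorem aux_swap01 {E : Type*} [AddCommGroup E] [Module ℝ E]
    (ω : E [⋀^Fin 3]→ₗ[ℝ] ℝ) (x a b : E) :
    ω ![a, x, b] = - ω ![x, a, b] := by
  rw [← ω.map_swap ![x, a, b] (show (0 : Fin 3) ≠ 1 by decide)]
  congr 1
  ext i; fin_cases i <;> rfl

theorem aux_swap12 {E : Type*} [AddCommGroup E] [Module ℝ E]
    (ω : E [⋀^Fin 3]→ₗ[ℝ] ℝ) (x a b : E) :
    ω ![x, b, a] = - ω ![x, a, b] := by
  rw [← ω.map_swap ![x, a, b] (show (1 : Fin 3) ≠ 2 by decide)]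
  congr 1
  ext i; fin_cases i <;> rfl

theorem aux_self {E : Type*} [AddCommGroup E] [Module ℝ E]
    (ω : E [⋀^Fin 3]→ₗ[ℝ] ℝ) (x a : E) : ω ![x, a, a] = 0 := by
  have := aux_swap12 ω x a a
  linarith

theorem aux_add1 {E : Type*} [AddCommGroup E] [Module ℝ E]
    (ω : E [⋀^Fin 3]→ₗ[ℝ] ℝ) (x y a b : E) :
    ω ![a, x + y, b] = ω ![a, x, b] + ω ![a, y, b] := by
  rw [aux_swap01, aux_add, aux_swap01 ω x a b, aux_swap01 ω y a b]; ring

theorem aux_smul1 {E : Type*} [AddCommGroup E] [Module ℝ E]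
    (ω : E [⋀^Fin 3]→ₗ[ℝ] ℝ) (c : ℝ) (x a b : E) :
    ω ![a, c • x, b] = c * ω ![a, x, b] := by
  rw [aux_swap01, aux_smul, aux_swap01 ω x a b]; ring

theorem aux_add2 {E : Type*} [AddCommGroup E] [Module ℝ E]
    (ω : E [⋀^Fin 3]→ₗ[ℝ] ℝ) (x y a b : E) :
    ω ![a, b, x + y] = ω ![a, b, x] + ω ![a, b, y] := by
  rw [aux_swap12, aux_add1, aux_swap12 ω a x b, aux_swap12 ω a y b]; ring

theorem aux_smul2 {E : Type*} [AddCommGroup E] [Module ℝ E]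
    (ω : E [⋀^Fin 3]→ₗ[ℝ] ℝ) (c : ℝ) (x a b : E) :
    ω ![a, b, c • x] = c * ω ![a, b, x] := by
  rw [aux_swap12, aux_smul1, aux_swap12 ω a x b]; ring

/-- If `E` is a real vector space of dimension `m ≥ 3`, `ω` a nondegenerate
alternating 3-form on `E`, and `e₁, e₂, e₃ ∈ E` satisfy `ω(e₁,e₂,e₃) = 1`, then with
`P₁ = span{e₁,e₂,e₃}` one has `E = P₁ ⊕ P₁^⊥`. -/
theorem span_isCompl_nambuComplement
    {E : Type*} [AddCommGroup E] [Module ℝ E] [FiniteDimensional ℝ E]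
    (hdim : 3 ≤ finrank ℝ E)
    (ω : E [⋀^Fin 3]→ₗ[ℝ] ℝ)
    (hnd : ∀ e₁ : E, e₁ ≠ 0 → ∃ e₂ e₃ : E, ω ![e₁, e₂, e₃] ≠ 0)
    (e₁ e₂ e₃ : E) (h1 : ω ![e₁, e₂, e₃] = 1) :
    IsCompl (Submodule.span ℝ {e₁, e₂, e₃})
      (nambuComplement ω (Submodule.span ℝ {e₁, e₂, e₃})) := by
  have s1 : e₁ ∈ Submodule.span ℝ {e₁, e₂, e₃} := Submodule.subset_span (by simp)
  have s2 : e₂ ∈ Submodule.span ℝ {e₁, e₂, e₃} := Submodule.subset_span (by simp)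
  have s3 : e₃ ∈ Submodule.span ℝ {e₁, e₂, e₃} := Submodule.subset_span (by simp)
  have z1 : ∀ a b, ω ![a, a, b] = 0 := fun a b => by
    have := aux_swap01 ω a a b
    linarith
  have z2 : ∀ a b, ω ![a, b, a] = 0 := fun a b => by
    rw [aux_swap12, z1, neg_zero]
  have h132 : ω ![e₁, e₃, e₂] = -1 := by rw [aux_swap12, h1]
  have h213 : ω ![e₂, e₁, e₃] = -1 := by rw [aux_swap01, h1]
  have h231 : ω ![e₂, e₃, e₁] = 1 := by rw [aux_swap12, h213, neg_neg]
  have h312 : ω ![e₃, e₁, e₂] = 1 := by rw [aux_swap01, h132, neg_neg]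
  have h321 : ω ![e₃, e₂, e₁] = -1 := by rw [aux_swap12, h312]
  constructor
  · rw [Submodule.disjoint_def]
    intro x hx hn
    have k1 := hn e₂ s2 e₃ s3
    have k2 := hn e₃ s3 e₁ s1
    have k3 := hn e₁ s1 e₂ s2
    obtain ⟨a, b, c, rfl⟩ := Submodule.mem_span_triple.1 hx
    simp only [aux_add, aux_smul, z1, z2, aux_self, h1, h231, h312, mul_zero, mul_one,
      add_zero, zero_add] at k1 k2 k3
    simp [k1, k2, k3]
  · rw [codisjoint_iff, Submodule.eq_top_iff']
    intro z
    rw [Submodule.mem_sup]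
    refine ⟨ω ![z, e₂, e₃] • e₁ + ω ![z, e₃, e₁] • e₂ + ω ![z, e₁, e₂] • e₃,
      Submodule.mem_span_triple.2 ⟨_, _, _, rfl⟩,
      z + (-1 : ℝ) • (ω ![z, e₂, e₃] • e₁ + ω ![z, e₃, e₁] • e₂ + ω ![z, e₁, e₂] • e₃),
      ?_, by module⟩
    intro u hu v hv
    obtain ⟨a, b, c, rfl⟩ := Submodule.mem_span_triple.1 hu
    obtain ⟨a', b', c', rfl⟩ := Submodule.mem_span_triple.1 hv
    have g1 := aux_swap12 ω z e₁ e₂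
    have g2 := aux_swap12 ω z e₂ e₃
    have g3 := aux_swap12 ω z e₃ e₁
    simp only [aux_add, aux_smul, aux_add1, aux_smul1, aux_add2, aux_smul2, z1, z2, aux_self,
      h1, h132, h213, h231, h312, h321, g1, g2, g3]
    ring
end
end

section
/- Let (E, ω) be a Nambu vector space of dimension m. Then m = 3n for a unique integer n ≥ 0, and there exists an ordered basis e₁, …, e_m of E with dual basis α¹, …, α^m such that ω = Σ_{i=0}^{n−1} α^{3i+1} ∧ α^{3i+2} ∧ α^{3i+3} (and ω = 0 if n = 0); equivalently, ω(e_a, e_b, e_c) equals the sign of the permutation (a, b, c) ↦ (3i+1, 3i+2, 3i+3) when {a, b, c} = {3i+1, 3i+2, 3i+3} for some 0 ≤ i ≤ n−1, and equals 0 otherwise. -/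
open Module

noncomputable section

/-- A 3-form is nondegenerate if every nonzero vector can be completed to a triple on
which the form does not vanish. -/
def Nondegenerate {E : Type*} [AddCommGroup E] [Module ℝ E]
    (ω : E [⋀^Fin 3]→ₗ[ℝ] ℝ) : Prop :=
  ∀ e₁ : E, e₁ ≠ 0 → ∃ e₂ e₃ : E, ω ![e₁, e₂, e₃] ≠ 0

/-- A 3-form is strictly nondegenerate if it is nondegenerate and for each nonzero `e₁`
there is a 2-dimensional subspace `E₁` such that, with `F₁ = span({e₁} ∪ E₁)`,
`ω(e₁, x₁, x₂) ≠ 0` for all `x₁, x₂ ∈ F₁` with `{e₁, x₁, x₂}` linearly independent, and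
`ω(e₁, z₁, z₂) = 0` for all `z₁, z₂` in the Nambu complement of `F₁`. -/
def StrictlyNondegenerate {E : Type*} [AddCommGroup E] [Module ℝ E]
    (ω : E [⋀^Fin 3]→ₗ[ℝ] ℝ) : Prop :=
  Nondegenerate ω ∧
  ∀ e₁ : E, e₁ ≠ 0 → ∃ E₁ : Submodule ℝ E, Module.finrank ℝ E₁ = 2 ∧
    (∀ x₁ x₂ : E, x₁ ∈ Submodule.span ℝ ({e₁} ∪ (E₁ : Set E)) →
      x₂ ∈ Submodule.span ℝ ({e₁} ∪ (E₁ : Set E)) →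
      LinearIndependent ℝ ![e₁, x₁, x₂] → ω ![e₁, x₁, x₂] ≠ 0) ∧
    (∀ z₁ z₂ : E, z₁ ∈ nambuComplement ω (Submodule.span ℝ ({e₁} ∪ (E₁ : Set E))) →
      z₂ ∈ nambuComplement ω (Submodule.span ℝ ({e₁} ∪ (E₁ : Set E))) →
      ω ![e₁, z₁, z₂] = 0)

/-- The Levi-Civita symbol on three indices: the sign of the permutation
`(p, l, m)` of `(0, 1, 2)`, and `0` if two indices coincide. -/
def epsilon3 (p l m : Fin 3) : ℝ :=
  Matrix.det (Matrix.of ![(Pi.single p 1 : Fin 3 → ℝ), Pi.single l 1, Pi.single m 1])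

section helpers
variable {E : Type*} [AddCommGroup E] [Module ℝ E] (ω : E [⋀^Fin 3]→ₗ[ℝ] ℝ)

theorem w_add1 (x x' y z : E) : ω ![x + x', y, z] = ω ![x, y, z] + ω ![x', y, z] := by
  show ω.curryLeft (x + x') ![y, z] = _
  rw [map_add]; rfl

theorem w_smul1 (c : ℝ) (x y z : E) : ω ![c • x, y, z] = c * ω ![x, y, z] := by
  show ω.curryLeft (c • x) ![y, z] = _
  rw [map_smul]; rfl

theorem w_swap12 (x y z : E) : ω ![y, x, z] = - ω ![x, y, z] := by
  rw [← ω.map_swap ![x, y, z] (i := 0) (j := 1) (by decide)]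
  congr 1; ext i; fin_cases i <;> simp [Equiv.swap_apply_def]

theorem w_swap23 (x y z : E) : ω ![x, z, y] = - ω ![x, y, z] := by
  rw [← ω.map_swap ![x, y, z] (i := 1) (j := 2) (by decide)]
  congr 1; ext i; fin_cases i <;> simp [Equiv.swap_apply_def]

theorem w_add2 (x y y' z : E) : ω ![x, y + y', z] = ω ![x, y, z] + ω ![x, y', z] := by
  rw [w_swap12, w_add1, w_swap12 ω x y, w_swap12 ω x y']; ring

theorem w_smul2 (c : ℝ) (x y z : E) : ω ![x, c • y, z] = c * ω ![x, y, z] := by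
  rw [w_swap12, w_smul1, w_swap12 ω x y]; ring

theorem w_add3 (x y z z' : E) : ω ![x, y, z + z'] = ω ![x, y, z] + ω ![x, y, z'] := by
  rw [w_swap23, w_add2, w_swap23 ω x y z, w_swap23 ω x y z']; ring

theorem w_smul3 (c : ℝ) (x y z : E) : ω ![x, y, c • z] = c * ω ![x, y, z] := by
  rw [w_swap23, w_smul2, w_swap23 ω x y]; ring

theorem w_self12 (x z : E) : ω ![x, x, z] = 0 := by
  have := w_swap12 ω x x z; linarith

theorem w_self23 (x z : E) : ω ![x, z, z] = 0 := by
  have := w_swap23 ω x z z; linarith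

theorem w_self13 (x z : E) : ω ![x, z, x] = 0 := by
  rw [w_swap23, w_self12, neg_zero]

theorem w_zero1 (y z : E) : ω ![0, y, z] = 0 := by
  have := w_smul1 ω 0 0 y z; simpa using this

/-- Membership in the complement of a space spanned by three vectors. -/
theorem mem_compl (F : Submodule ℝ E) (e f g z : E)
    (hF : ∀ w ∈ F, ∃ a b c : ℝ, w = a • e + b • f + c • g)
    (h1 : ω ![z, e, f] = 0) (h2 : ω ![z, e, g] = 0) (h3 : ω ![z, f, g] = 0) :
    z ∈ nambuComplement ω F := by
  intro z₁ hz₁ z₂ hz₂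
  obtain ⟨a, b, c, rfl⟩ := hF z₁ hz₁
  obtain ⟨a', b', c', rfl⟩ := hF z₂ hz₂
  simp only [w_add2, w_add3, w_smul2, w_smul3, w_self23, h1, h2, h3, w_swap23 ω z e f,
    w_swap23 ω z e g, w_swap23 ω z f g]
  ring

theorem exists_pair (hω : StrictlyNondegenerate ω) (e : E) (he : e ≠ 0) :
    ∃ f g : E, ω ![e, f, g] ≠ 0 ∧ ∀ x y, ω ![e, f, x] = 0 → ω ![e, g, x] = 0 →
      ω ![e, f, y] = 0 → ω ![e, g, y] = 0 → ω ![e, x, y] = 0 := by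
  obtain ⟨E₁, hd, hi, hii⟩ := hω.2 e he
  have hfin : FiniteDimensional ℝ E₁ := FiniteDimensional.of_finrank_pos (by omega)
  let b := Module.finBasisOfFinrankEq ℝ E₁ hd
  have hE : ∀ w ∈ E₁, ∃ s t : ℝ, w = s • (b 0 : E) + t • (b 1 : E) := by
    intro w hw
    refine ⟨b.repr ⟨w, hw⟩ 0, b.repr ⟨w, hw⟩ 1, ?_⟩
    have h := b.sum_repr ⟨w, hw⟩
    rw [Fin.sum_univ_two] at h
    exact (congrArg Subtype.val h).symm
  have hspan : ∀ w ∈ Submodule.span ℝ ({e} ∪ (E₁ : Set E)), ∃ a : ℝ, ∃ v ∈ E₁,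
      w = a • e + v := by
    intro w hw
    rw [Submodule.span_union, Submodule.span_eq, Submodule.mem_sup] at hw
    obtain ⟨y, hy, v, hv, rfl⟩ := hw
    obtain ⟨a, rfl⟩ := Submodule.mem_span_singleton.1 hy
    exact ⟨a, v, hv, rfl⟩
  by_cases hmem : e ∈ E₁
  · -- degenerate case
    have hf : ∃ f ∈ E₁, ∀ w ∈ E₁, ∃ s t : ℝ, w = s • e + t • f := by
      obtain ⟨p, q, hpq⟩ := hE e hmem
      by_cases hp : p = 0
      · have hq : q ≠ 0 := by
          rintro rfl; apply he; rw [hpq, hp]; simp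
        refine ⟨b 0, (b 0).2, fun w hw => ?_⟩
        obtain ⟨s, t, rfl⟩ := hE w hw
        refine ⟨t / q, s, ?_⟩
        rw [hpq, hp, zero_smul, zero_add, smul_smul, div_mul_cancel₀ _ hq, add_comm]
      · refine ⟨b 1, (b 1).2, fun w hw => ?_⟩
        obtain ⟨s, t, rfl⟩ := hE w hw
        refine ⟨s / p, t - s / p * q, ?_⟩
        rw [hpq, smul_add, smul_smul, smul_smul, div_mul_cancel₀ _ hp, sub_smul]
        abel
    obtain ⟨f, hfE, hf⟩ := hf
    have hF : ∀ w ∈ Submodule.span ℝ ({e} ∪ (E₁ : Set E)), ∃ a b c : ℝ,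
        w = a • e + b • f + c • f := by
      intro w hw
      obtain ⟨a, v, hv, rfl⟩ := hspan w hw
      obtain ⟨s, t, rfl⟩ := hf v hv
      exact ⟨a + s, t, 0, by module⟩
    have hc : ∀ z, ω ![e, f, z] = 0 →
        z ∈ nambuComplement ω (Submodule.span ℝ ({e} ∪ (E₁ : Set E))) := by
      intro z hz
      have h : ω ![z, e, f] = 0 := by
        rw [w_swap12, w_swap23, hz]; simp
      exact mem_compl ω _ e f f z hF h h (w_self23 ω z f)
    have hg : ∃ g, ω ![e, f, g] ≠ 0 := by
      by_contra! hcon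
      obtain ⟨x, y, hxy⟩ := hω.1 e he
      exact hxy (hii x y (hc x (hcon x)) (hc y (hcon y)))
    obtain ⟨g, hg⟩ := hg
    exact ⟨f, g, hg, fun x y hx _ hy _ => hii x y (hc x hx) (hc y hy)⟩
  · set f : E := ((b 0 : E₁) : E) with hfdef
    set g : E := ((b 1 : E₁) : E) with hgdef
    have hF : ∀ w ∈ Submodule.span ℝ ({e} ∪ (E₁ : Set E)), ∃ a b c : ℝ,
        w = a • e + b • f + c • g := by
      intro w hw
      obtain ⟨a, v, hv, rfl⟩ := hspan w hw
      obtain ⟨s, t, rfl⟩ := hE v hv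
      exact ⟨a, s, t, by module⟩
    have hfg : LinearIndependent ℝ ![f, g] := by
      have h := b.linearIndependent.map' E₁.subtype (Submodule.ker_subtype _)
      have h2 : ![f, g] = E₁.subtype ∘ b := by
        ext i; fin_cases i <;> rfl
      rwa [h2]
    have hli : LinearIndependent ℝ ![e, f, g] := by
      refine linearIndependent_finCons.2 ⟨hfg, fun h => hmem ?_⟩
      refine Submodule.span_le.2 ?_ h
      rintro _ ⟨i, rfl⟩
      fin_cases i
      · exact (b 0).2
      · exact (b 1).2
    have hs : ω ![e, f, g] ≠ 0 :=
      hi f g (Submodule.subset_span (Or.inr (b 0).2)) (Submodule.subset_span (Or.inr (b 1).2)) hli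
    have hc : ∀ z, ω ![e, f, z] = 0 → ω ![e, g, z] = 0 →
        z + (-(ω ![z, f, g] / ω ![e, f, g])) • e ∈
          nambuComplement ω (Submodule.span ℝ ({e} ∪ (E₁ : Set E))) := by
      intro z h1 h2
      have h1' : ω ![z, e, f] = 0 := by
        rw [w_swap12, w_swap23, h1]; simp
      have h2' : ω ![z, e, g] = 0 := by
        rw [w_swap12, w_swap23, h2]; simp
      refine mem_compl ω _ e f g _ hF ?_ ?_ ?_
      · rw [w_add1, w_smul1, w_self12, h1']; simp
      · rw [w_add1, w_smul1, w_self12, h2']; simp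
      · rw [w_add1, w_smul1]; field_simp; ring
    refine ⟨f, g, hs, fun x y h1 h2 h3 h4 => ?_⟩
    have := hii _ _ (hc x h1 h2) (hc y h3 h4)
    simpa only [w_add2, w_add3, w_smul2, w_smul3, w_self12, w_self13, mul_zero, add_zero]
      using this

theorem plucker (hω : StrictlyNondegenerate ω) (e a b c d : E) :
    ω ![e, a, b] * ω ![e, c, d] - ω ![e, a, c] * ω ![e, b, d]
      + ω ![e, a, d] * ω ![e, b, c] = 0 := by
  by_cases he : e = 0
  · subst he; simp [w_zero1]
  obtain ⟨f, g, hs, h⟩ := exists_pair ω hω e he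
  set s := ω ![e, f, g] with hsdef
  have key : ∀ x y, s * ω ![e, x, y]
      = ω ![e, f, x] * ω ![e, g, y] - ω ![e, g, x] * ω ![e, f, y] := by
    intro x y
    have hperp : ∀ x, ω ![e, f, s • x + ω ![e, g, x] • f + (-ω ![e, f, x]) • g] = 0 ∧
        ω ![e, g, s • x + ω ![e, g, x] • f + (-ω ![e, f, x]) • g] = 0 := by
      intro x
      simp only [w_add3, w_smul3, w_self23, w_swap23 ω e f g, ← hsdef]
      constructor <;> ring
    have h1 := h _ _ (hperp x).1 (hperp x).2 (hperp y).1 (hperp y).2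
    simp only [w_add2, w_add3, w_smul2, w_smul3, w_self23, w_swap23 ω e f g, ← hsdef,
      w_swap23 ω e f x, w_swap23 ω e g x] at h1
    apply mul_left_cancel₀ hs
    linear_combination h1
  have h2 : s * s ≠ 0 := mul_ne_zero hs hs
  apply mul_left_cancel₀ h2
  linear_combination (s * ω ![e, c, d]) * key a b + (ω ![e, f, a] * ω ![e, g, b] - ω ![e, g, a] * ω ![e, f, b]) * key c d
    - (s * ω ![e, b, d]) * key a c - (ω ![e, f, a] * ω ![e, g, c] - ω ![e, g, a] * ω ![e, f, c]) * key b d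
    + (s * ω ![e, b, c]) * key a d + (ω ![e, f, a] * ω ![e, g, d] - ω ![e, g, a] * ω ![e, f, d]) * key b c

theorem eq_comb (hω : StrictlyNondegenerate ω) (p q r : E) (h : ω ![p, q, r] = 1) (v : E) :
    v = ω ![v, q, r] • p + ω ![p, v, r] • q + ω ![p, q, v] • r := by
  set z := v + ((-ω ![v, q, r]) • p + (-ω ![p, v, r]) • q + (-ω ![p, q, v]) • r) with hz
  have h12 : ω ![p, q, z] = 0 := by
    rw [hz]; simp only [w_add3, w_smul3, w_self13, w_self23, h]; ring
  have h13 : ω ![p, r, z] = 0 := by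
    rw [hz]
    simp only [w_add3, w_smul3, w_self13, w_self23, w_swap23 ω p q r, w_swap23 ω p v r, h]; ring
  have h23 : ω ![q, r, z] = 0 := by
    have e1 : ω ![q, r, v] = ω ![v, q, r] := by
      rw [w_swap23, w_swap12]; ring
    have e2 : ω ![q, r, p] = 1 := by
      rw [w_swap23, w_swap12, h]; ring
    rw [hz]; simp only [w_add3, w_smul3, w_self13, w_self23, e1, e2]; ring
  have hp : ∀ y, ω ![p, z, y] = 0 := by
    intro y
    have := plucker ω hω p q r z y
    rw [h, h12, h13] at this
    linarith
  have hz0 : z = 0 := by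
    by_contra hne
    obtain ⟨x, y, hxy⟩ := hω.1 z hne
    have hq : ∀ y, ω ![z, q, y] = 0 := by
      intro y
      have := plucker ω hω q r p z y
      rw [h23, show ω ![q, r, p] = 1 by rw [w_swap23, w_swap12, h]; ring,
        show ω ![q, p, z] = 0 by rw [w_swap12, h12]; ring] at this
      rw [w_swap12]; linarith
    have hr : ∀ y, ω ![z, r, y] = 0 := by
      intro y
      have := plucker ω hω r p q z y
      rw [show ω ![r, p, q] = 1 by rw [w_swap12, w_swap23, h]; ring,
        show ω ![r, p, z] = 0 by rw [w_swap12, h13]; ring,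
        show ω ![r, q, z] = 0 by rw [w_swap12, h23]; ring] at this
      rw [w_swap12]; linarith
    have h1 := plucker ω hω (p + z) q r x y
    have h2 := plucker ω hω p q r x y
    simp only [w_add1, hq, hr, h] at h1 h2
    apply hxy; linarith
  have : v = z + (ω ![v, q, r] • p + ω ![p, v, r] • q + ω ![p, q, v] • r) := by
    rw [hz]; module
  rw [hz0, zero_add] at this
  exact this

end helpers

/-- **Nambu–Darboux basis.** A Nambu vector space `(E, ω)` (finite-dimensional,
with `ω` a strictly nondegenerate alternating 3-form) has dimension `m = 3n` for a unique
`n : ℕ`, and admits an ordered basis `e_{(i,p)}` (the index `(i, p)` corresponding to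
`3i + p + 1`) in which `ω = Σ_{i=0}^{n-1} α^{3i+1} ∧ α^{3i+2} ∧ α^{3i+3}`; equivalently,
on basis vectors `ω(e_a, e_b, e_c)` is the Levi-Civita sign of `(a.2, b.2, c.2)` when the
three indices lie in one block `a.1 = b.1 = c.1`, and is `0` otherwise. -/
theorem nambu_darboux_basis
    {E : Type*} [AddCommGroup E] [Module ℝ E] [FiniteDimensional ℝ E]
    (ω : E [⋀^Fin 3]→ₗ[ℝ] ℝ) (hω : StrictlyNondegenerate ω) :
    ∃! n : ℕ, Module.finrank ℝ E = 3 * n ∧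
      ∃ b : Basis (Fin n × Fin 3) ℝ E,
        ∀ a a' a'' : Fin n × Fin 3,
          ω ![b a, b a', b a''] =
            if a.1 = a'.1 ∧ a'.1 = a''.1 then epsilon3 a.2 a'.2 a''.2 else 0 := by
  rcases subsingleton_or_nontrivial E with hE | hE
  · refine ⟨0, ⟨by simp [Module.finrank_zero_of_subsingleton], Basis.empty E,
      fun a => Fin.elim0 a.1⟩, ?_⟩
    rintro n ⟨hn, -⟩
    rw [Module.finrank_zero_of_subsingleton] at hn
    omega
  · obtain ⟨p, hp⟩ := exists_ne (0 : E)
    obtain ⟨q, r', hr'⟩ := hω.1 p hp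
    obtain ⟨r, h⟩ : ∃ r, ω ![p, q, r] = 1 :=
      ⟨(ω ![p, q, r'])⁻¹ • r', by rw [w_smul3]; exact inv_mul_cancel₀ hr'⟩
    have hli : LinearIndependent ℝ ![p, q, r] := by
      rw [Fintype.linearIndependent_iff]
      intro c hc
      simp only [Fin.sum_univ_three, Matrix.cons_val_zero, Matrix.cons_val_one,
        Matrix.cons_val] at hc
      have h0 : ω ![c 0 • p + c 1 • q + c 2 • r, q, r] = 0 := by rw [hc, w_zero1]
      have h1 : ω ![c 0 • p + c 1 • q + c 2 • r, p, r] = 0 := by rw [hc, w_zero1]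
      have h2 : ω ![c 0 • p + c 1 • q + c 2 • r, p, q] = 0 := by rw [hc, w_zero1]
      have e1 : ω ![q, p, r] = -1 := by rw [w_swap12, h]
      have e2 : ω ![r, p, q] = 1 := by rw [w_swap12, w_swap23, h]; ring
      simp only [w_add1, w_smul1, w_self12, w_self13, h, e1, e2] at h0 h1 h2
      intro i
      fin_cases i
      · show c 0 = 0
        linarith
      · show c 1 = 0
        linarith
      · show c 2 = 0
        linarith
    have hsp : ⊤ ≤ Submodule.span ℝ (Set.range ![p, q, r]) := by
      intro v _
      rw [eq_comb ω hω p q r h v]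
      have hm : ∀ i, ![p, q, r] i ∈ Submodule.span ℝ (Set.range ![p, q, r]) :=
        fun i => Submodule.subset_span ⟨i, rfl⟩
      exact Submodule.add_mem _ (Submodule.add_mem _ (Submodule.smul_mem _ _ (hm 0))
        (Submodule.smul_mem _ _ (hm 1))) (Submodule.smul_mem _ _ (hm 2))
    let b := Basis.mk hli hsp
    have hdim : Module.finrank ℝ E = 3 := by
      rw [Module.finrank_eq_card_basis b]; simp
    refine ⟨1, ⟨by rw [hdim], b.reindex (Equiv.uniqueProd (Fin 3) (Fin 1)).symm, ?_⟩, ?_⟩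
    · have e1 : ω ![q, p, r] = -1 := by rw [w_swap12, h]
      have e2 : ω ![r, p, q] = 1 := by rw [w_swap12, w_swap23, h]; ring
      have e3 : ω ![p, r, q] = -1 := by rw [w_swap23, h]
      have e4 : ω ![q, r, p] = 1 := by rw [w_swap23, w_swap12, h]; ring
      have e5 : ω ![r, q, p] = -1 := by rw [w_swap23, e2]
      rintro ⟨i, a⟩ ⟨j, a'⟩ ⟨k, a''⟩
      have hb : ∀ (i : Fin 1) (a : Fin 3),
          b.reindex (Equiv.uniqueProd (Fin 3) (Fin 1)).symm (i, a) = ![p, q, r] a := by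
        intro i a
        simp [b]
      rw [hb, hb, hb, if_pos ⟨Subsingleton.elim _ _, Subsingleton.elim _ _⟩]
      fin_cases a <;> fin_cases a' <;> fin_cases a'' <;>
        simp [epsilon3, Matrix.det_fin_three, w_self12, w_self13, w_self23, h, e1, e2, e3, e4, e5]
    · rintro n ⟨hn, -⟩
      omega
end
end

section
/- The space of smooth 2-form fields on ℝ^{3n} forms a Lie algebra under the Nambu–Poisson bracket: for all smooth 2-form fields α, β, γ, (1) {α + γ, β} = {α, β} + {γ, β} and {α, β + γ} = {α, β} + {α, γ} (and the bracket is ℝ-bilinear), (2) {α, α} = 0, and (3) the Jacobi identity holds: {α, {β, γ}} + {β, {γ, α}} + {γ, {α, β}} = 0. -/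
noncomputable section

/-- The model space `ℝ^{3n}`, realized as `Fin n × Fin 3 → ℝ`; the index `(i, p)`
corresponds to the coordinate `x_{3i+p+1}`. -/
abbrev V (n : ℕ) : Type := Fin n × Fin 3 → ℝ

/-- The standard basis vector `e_{(i,p)}` of `ℝ^{3n}`. -/
def stdVec (n : ℕ) (i : Fin n) (p : Fin 3) : V n := Pi.single (i, p) 1

/-- The Levi-Civita symbol `ε_{plm}` on three indices. -/
def eps (p l m : Fin 3) : ℝ :=
  Matrix.det (Matrix.of ![(Pi.single p 1 : Fin 3 → ℝ), Pi.single l 1, Pi.single m 1])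

/-- The standard Nambu 3-form `ω = Σ_{i=0}^{n-1} dx_{3i+1} ∧ dx_{3i+2} ∧ dx_{3i+3}`
on `ℝ^{3n}`, evaluated on three vectors. -/
def omega3 (n : ℕ) (u v w : V n) : ℝ :=
  ∑ i : Fin n,
    Matrix.det (Matrix.of ![(fun p => u (i, p)), (fun p => v (i, p)), (fun p => w (i, p))])

/-- `X^♭ = i_X ω`: the 2-form obtained by contracting the standard Nambu 3-form with `X`. -/
def flat (n : ℕ) (X : V n) : V n → V n → ℝ := fun u v => omega3 n X u v

/-- `α^♯`: the vector associated to a 2-form `α`, with components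
`(α^♯)_{3i+p} = (1/2) Σ_{l,m} ε_{plm} α_{3i+l, 3i+m}`. -/
def sharp (n : ℕ) (α : V n → V n → ℝ) : V n :=
  fun q => (1 / 2) * ∑ l : Fin 3, ∑ m : Fin 3,
    eps q.2 l m * α (stdVec n q.1 l) (stdVec n q.1 m)

/-- A smooth 2-form field on `ℝ^{3n}`: at each point it is an alternating bilinear form,
depending smoothly on the point. -/
structure IsSmooth2FormField (n : ℕ) (α : V n → V n → V n → ℝ) : Prop where
  add_left : ∀ (x u u' v : V n), α x (u + u') v = α x u v + α x u' v
  smul_left : ∀ (x : V n) (c : ℝ) (u v : V n), α x (c • u) v = c * α x u v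
  add_right : ∀ (x u v v' : V n), α x u (v + v') = α x u v + α x u v'
  smul_right : ∀ (x : V n) (c : ℝ) (u v : V n), α x u (c • v) = c * α x u v
  alt : ∀ x u : V n, α x u u = 0
  smooth : ∀ u v : V n, ContDiff ℝ (⊤ : ℕ∞) (fun x => α x u v)

/-- The vector field `α^♯` associated to a 2-form field `α`, obtained by applying `♯`
pointwise. -/
def sharpField (n : ℕ) (α : V n → V n → V n → ℝ) : V n → V n := fun x => sharp n (α x)

/-- The Lie bracket of vector fields on `ℝ^{3n}`: `[X, Y](x) = DY(x)·X(x) - DX(x)·Y(x)`. -/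
def lieBracketVF (n : ℕ) (X Y : V n → V n) : V n → V n :=
  fun x => fderiv ℝ Y x (X x) - fderiv ℝ X x (Y x)

/-- The Nambu–Poisson bracket of 2-form fields: `{α, β} = ([α^♯, β^♯])^♭`. -/
def npBracket (n : ℕ) (α β : V n → V n → V n → ℝ) : V n → V n → V n → ℝ :=
  fun x u v => omega3 n (lieBracketVF n (sharpField n α) (sharpField n β) x) u v

theorem omega3_add (n : ℕ) (a b u v : V n) :
    omega3 n (a + b) u v = omega3 n a u v + omega3 n b u v := by
  simp only [omega3, Matrix.det_fin_three, ← Finset.sum_add_distrib]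
  refine Finset.sum_congr rfl fun i _ => ?_
  simp
  ring

theorem omega3_smul (n : ℕ) (c : ℝ) (a u v : V n) :
    omega3 n (c • a) u v = c * omega3 n a u v := by
  simp only [omega3, Matrix.det_fin_three, Finset.mul_sum]
  refine Finset.sum_congr rfl fun i _ => ?_
  simp
  ring

theorem omega3_zero (n : ℕ) (u v : V n) : omega3 n 0 u v = 0 := by
  simpa using omega3_smul n 0 0 u v

theorem sharp_omega3 (n : ℕ) (X : V n) : sharp n (fun u v => omega3 n X u v) = X := by
  have key : ∀ (i : Fin n) (l m : Fin 3), omega3 n X (stdVec n i l) (stdVec n i m) =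
      Matrix.det (Matrix.of ![(fun p => X (i, p)), Pi.single l 1, Pi.single m 1]) := by
    intro i l m
    unfold omega3
    rw [Finset.sum_eq_single i]
    · congr 3
      ext a b
      fin_cases a <;> simp [stdVec, Pi.single_apply]
    · intro j _ hj
      simp [Matrix.det_fin_three, stdVec, Pi.single_apply, hj]
    · simp
  funext ⟨i, p⟩
  simp only [sharp, key, eps, Matrix.det_fin_three]
  fin_cases p <;> simp [Fin.sum_univ_three, Pi.single_apply] <;> ring

theorem sharpField_contDiff (n : ℕ) (α : V n → V n → V n → ℝ)
    (h : IsSmooth2FormField n α) : ContDiff ℝ (⊤ : ℕ∞) (sharpField n α) := by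
  rw [contDiff_pi]
  intro q
  simp only [sharpField, sharp]
  refine contDiff_const.mul (ContDiff.sum fun l _ => ContDiff.sum fun m _ => ?_)
  exact contDiff_const.mul (h.smooth _ _)

theorem lieBracketVF_eq (n : ℕ) (X Y : V n → V n) :
    lieBracketVF n X Y = VectorField.lieBracket ℝ X Y := rfl

theorem sharpField_npBracket (n : ℕ) (α β : V n → V n → V n → ℝ) :
    sharpField n (npBracket n α β) =
      VectorField.lieBracket ℝ (sharpField n α) (sharpField n β) := by
  funext x
  exact sharp_omega3 n _

theorem sharpField_add (n : ℕ) (α β : V n → V n → V n → ℝ) :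
    sharpField n (fun x u v => α x u v + β x u v) = sharpField n α + sharpField n β := by
  funext x q
  simp only [sharpField, sharp, Pi.add_apply, mul_add, Finset.sum_add_distrib]

theorem sharpField_smul (n : ℕ) (c : ℝ) (α : V n → V n → V n → ℝ) :
    sharpField n (fun x u v => c * α x u v) = c • sharpField n α := by
  funext x q
  simp only [sharpField, sharp, Pi.smul_apply, smul_eq_mul, Finset.mul_sum]
  refine Finset.sum_congr rfl fun l _ => Finset.sum_congr rfl fun m _ => ?_
  ring

/-- The smooth 2-form fields on `ℝ^{3n}` form a Lie algebra under the
Nambu–Poisson bracket: the bracket is ℝ-bilinear, alternating (`{α, α} = 0`), and satisfies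
the Jacobi identity. -/
theorem npBracket_lie_algebra (n : ℕ)
    (α β γ : V n → V n → V n → ℝ)
    (hα : IsSmooth2FormField n α) (hβ : IsSmooth2FormField n β)
    (hγ : IsSmooth2FormField n γ) (c : ℝ) :
    (npBracket n (fun x u v => α x u v + γ x u v) β =
        fun x u v => npBracket n α β x u v + npBracket n γ β x u v) ∧
    (npBracket n α (fun x u v => β x u v + γ x u v) =
        fun x u v => npBracket n α β x u v + npBracket n α γ x u v) ∧
    (npBracket n (fun x u v => c * α x u v) β = fun x u v => c * npBracket n α β x u v) ∧
    (npBracket n α (fun x u v => c * β x u v) = fun x u v => c * npBracket n α β x u v) ∧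
    (npBracket n α α = fun _ _ _ => 0) ∧
    (∀ x u v : V n,
      npBracket n α (npBracket n β γ) x u v + npBracket n β (npBracket n γ α) x u v +
        npBracket n γ (npBracket n α β) x u v = 0) := by
  have cα := sharpField_contDiff n α hα
  have cβ := sharpField_contDiff n β hβ
  have cγ := sharpField_contDiff n γ hγ
  have dα : Differentiable ℝ (sharpField n α) := cα.differentiable (by simp)
  have dβ : Differentiable ℝ (sharpField n β) := cβ.differentiable (by simp)
  have dγ : Differentiable ℝ (sharpField n γ) := cγ.differentiable (by simp)
  refine ⟨?_, ?_, ?_, ?_, ?_, ?_⟩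
  · funext x u v
    simp only [npBracket, lieBracketVF_eq, sharpField_add]
    rw [VectorField.lieBracket_add_left (dα x) (dγ x), omega3_add]
  · funext x u v
    simp only [npBracket, lieBracketVF_eq, sharpField_add]
    rw [VectorField.lieBracket_add_right (dβ x) (dγ x), omega3_add]
  · funext x u v
    simp only [npBracket, lieBracketVF_eq, sharpField_smul]
    rw [VectorField.lieBracket_const_smul_left (dα x), omega3_smul]
  · funext x u v
    simp only [npBracket, lieBracketVF_eq, sharpField_smul]
    rw [VectorField.lieBracket_const_smul_right (dβ x), omega3_smul]
  · funext x u v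
    simp only [npBracket, lieBracketVF_eq, VectorField.lieBracket_self]
    exact omega3_zero n u v
  · intro x u v
    have h2top : (2 : WithTop ℕ∞) ≤ ((⊤ : ℕ∞) : WithTop ℕ∞) :=
      WithTop.coe_le_coe.2 (le_top : (2 : ℕ∞) ≤ ⊤)
    have hn : minSmoothness ℝ 2 ≤ ((⊤ : ℕ∞) : WithTop ℕ∞) := by
      rw [minSmoothness_of_isRCLikeNormedField]
      exact h2top
    have J := VectorField.leibniz_identity_lieBracket hn
      (cα.contDiffAt (x := x)) (cβ.contDiffAt (x := x)) (cγ.contDiffAt (x := x))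
    have s1 : VectorField.lieBracket ℝ (sharpField n γ) (sharpField n α) =
        (-1 : ℝ) • VectorField.lieBracket ℝ (sharpField n α) (sharpField n γ) := by
      funext y
      rw [VectorField.lieBracket_swap]
      simp
    have dαγ : DifferentiableAt ℝ
        (VectorField.lieBracket ℝ (sharpField n α) (sharpField n γ)) x := by
      have h1 : Differentiable ℝ (fderiv ℝ (sharpField n γ)) :=
        (cγ.fderiv_right (m := 1) (by rw [one_add_one_eq_two]; exact h2top)).differentiable (by simp)
      have h2 : Differentiable ℝ (fderiv ℝ (sharpField n α)) :=
        (cα.fderiv_right (m := 1) (by rw [one_add_one_eq_two]; exact h2top)).differentiable (by simp)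
      exact ((h1 x).clm_apply (dα x)).sub ((h2 x).clm_apply (dγ x))
    have e : ∀ a b : V n → V n → V n → ℝ, npBracket n a b x u v =
      omega3 n (VectorField.lieBracket ℝ (sharpField n a) (sharpField n b) x) u v :=
      fun _ _ => rfl
    rw [e, e, e]
    simp only [sharpField_npBracket]
    rw [← omega3_add, ← omega3_add, J, s1, VectorField.lieBracket_const_smul_right dαγ,
      VectorField.lieBracket_swap (V := sharpField n γ)]
    convert omega3_zero n u v using 2
    module
end
end

section
/- Let α, β be smooth 2-form fields on ℝ^{3n} whose associated vector fields α^♯, β^♯ are complete. Then the Nambu–Poisson bracket satisfies {α, β} = L_{α^♯}((β^♯)^♭) − L_{β^♯}((α^♯)^♭) − d(i_{α^♯} i_{β^♯} ω), where i_{α^♯} i_{β^♯} ω is the 1-form field v ↦ ω(β^♯, α^♯, v). -/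
noncomputable section

/-- `F` is the (global) flow of the vector field `X` on `ℝ^{3n}`:
`F 0 = id` and `(d/dt) F t x = X (F t x)`; a flow of a smooth vector field is smooth. -/
structure IsFlow (n : ℕ) (X : V n → V n) (F : ℝ → V n → V n) : Prop where
  init : ∀ x, F 0 x = x
  deriv : ∀ t x, HasDerivAt (fun s => F s x) (X (F t x)) t
  smooth : ContDiff ℝ (⊤ : ℕ∞) (fun p : ℝ × V n => F p.1 p.2)

/-- The Lie derivative of a 2-form field `η` along the flow `F` of a vector field:
`(L_X η)_x(u,v) = (d/dt)|_{t=0} ((F t)^* η)_x(u,v)`. -/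
def lieDeriv2 (n : ℕ) (F : ℝ → V n → V n) (η : V n → V n → V n → ℝ) :
    V n → V n → V n → ℝ :=
  fun x u v =>
    deriv (fun t => η (F t x) (fderiv ℝ (F t) x u) (fderiv ℝ (F t) x v)) 0

/-- The exterior derivative of a 1-form field `θ` on `ℝ^{3n}`, evaluated on constant
vector fields: `(dθ)_x(u,v) = D_u θ(v) - D_v θ(u)`. -/
def extDeriv1 (n : ℕ) (θ : V n → V n → ℝ) : V n → V n → V n → ℝ :=
  fun x u v => fderiv ℝ (fun y => θ y v) x u - fderiv ℝ (fun y => θ y u) x v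

theorem np_omega3_hasDerivAt (n : ℕ) {a b c : ℝ → V n} {a' b' c' : V n} {t : ℝ}
    (ha : HasDerivAt a a' t) (hb : HasDerivAt b b' t) (hc : HasDerivAt c c' t) :
    HasDerivAt (fun s => omega3 n (a s) (b s) (c s))
      (omega3 n a' (b t) (c t) + omega3 n (a t) b' (c t) + omega3 n (a t) (b t) c') t := by
  have ha := hasDerivAt_pi.1 ha
  have hb := hasDerivAt_pi.1 hb
  have hc := hasDerivAt_pi.1 hc
  unfold omega3
  rw [← Finset.sum_add_distrib, ← Finset.sum_add_distrib]
  refine HasDerivAt.fun_sum fun i _ => ?_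
  simp only [Matrix.det_fin_three, Matrix.of_apply, Matrix.cons_val]
  have key : ∀ p q r : Fin 3, HasDerivAt (fun s => a s (i, p) * b s (i, q) * c s (i, r))
      ((a' (i, p) * b t (i, q) + a t (i, p) * b' (i, q)) * c t (i, r)
        + a t (i, p) * b t (i, q) * c' (i, r)) t := fun p q r =>
    ((ha (i, p)).fun_mul (hb (i, q))).fun_mul (hc (i, r))
  have := ((((((key 0 1 2).fun_sub (key 0 2 1)).fun_sub (key 1 0 2)).fun_add (key 2 0 1)).fun_add
    (key 1 2 0)).fun_sub (key 2 1 0))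
  refine (this.congr_deriv ?_).congr_of_eventuallyEq (Filter.Eventually.of_forall fun s => ?_)
  · ring
  · simp only []
    ring

theorem np_sharp_smooth (n : ℕ) {α : V n → V n → V n → ℝ} (hα : IsSmooth2FormField n α) :
    ContDiff ℝ (⊤ : ℕ∞) (sharpField n α) := by
  refine contDiff_pi.2 fun q => ?_
  unfold sharpField sharp
  refine contDiff_const.mul (ContDiff.sum fun l _ => ContDiff.sum fun m _ => ?_)
  exact contDiff_const.mul (hα.smooth _ _)

theorem np_flow_deriv (n : ℕ) {X : V n → V n} {F : ℝ → V n → V n} (hF : IsFlow n X F)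
    (x u : V n) :
    HasDerivAt (fun t => fderiv ℝ (F t) x u) (fderiv ℝ X x u) 0 := by
  set G : ℝ × V n → V n := fun p => F p.1 p.2 with hG
  have hd : Differentiable ℝ G := hF.smooth.differentiable (by simp)
  have hs2 : ContDiff ℝ 2 G := by exact_mod_cast contDiff_infty.1 hF.smooth 2
  have hs : ContDiff ℝ 1 (fderiv ℝ G) := hs2.fderiv_right (by norm_num)
  have hd2 : Differentiable ℝ (fderiv ℝ G) := hs.differentiable (by simp)
  have h1 : ∀ t y w, fderiv ℝ (F t) y w = fderiv ℝ G (t, y) (0, w) := by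
    intro t y w
    have : HasFDerivAt (F t) _ y := (hd (t, y)).hasFDerivAt.comp y (hasFDerivAt_prodMk_right t y)
    rw [this.fderiv]
    simp
  have h2 : ∀ y, fderiv ℝ G (0, y) (1, 0) = X y := by
    intro y
    have h3 : HasDerivAt (fun s => F s y) (fderiv ℝ G (0, y) (1, 0)) 0 := by
      have := (hd (0, y)).hasFDerivAt.comp_hasDerivAt (0 : ℝ)
        ((hasDerivAt_id (0 : ℝ)).prodMk (hasDerivAt_const (0 : ℝ) y))
      exact this
    have h4 := hF.deriv 0 y
    rw [hF.init] at h4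
    exact h3.unique h4
  have hX : X = fun y => fderiv ℝ G (0, y) (1, 0) := funext fun y => (h2 y).symm
  have h5 : fderiv ℝ X x u = fderiv ℝ (fderiv ℝ G) (0, x) (0, u) (1, 0) := by
    have h6 : HasFDerivAt (fun y => fderiv ℝ G (0, y)) _ x :=
      (hd2 (0, x)).hasFDerivAt.comp x (hasFDerivAt_prodMk_right (0 : ℝ) x)
    have h7 := h6.clm_apply (hasFDerivAt_const ((1, 0) : ℝ × V n) x)
    rw [hX, h7.fderiv]
    simp
  have hsymm : IsSymmSndFDerivAt ℝ G (0, x) :=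
    (hs2.contDiffAt).isSymmSndFDerivAt (by simp)
  rw [h5, hsymm.eq]
  have h8 : HasDerivAt (fun t : ℝ => fderiv ℝ G (t, x)) (fderiv ℝ (fderiv ℝ G) (0, x) (1, 0)) 0 := by
    have := (hd2 (0, x)).hasFDerivAt.comp_hasDerivAt (0 : ℝ)
        ((hasDerivAt_id (0 : ℝ)).prodMk (hasDerivAt_const (0 : ℝ) x))
    exact this
  have h9 := h8.clm_apply (hasDerivAt_const (0 : ℝ) ((0, u) : ℝ × V n))
  simp only [h1]
  simpa using h9

theorem np_lieDeriv2 (n : ℕ) {X Y : V n → V n} {F : ℝ → V n → V n} (hF : IsFlow n X F)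
    (hY : ContDiff ℝ (⊤ : ℕ∞) Y) (x u v : V n) :
    lieDeriv2 n F (fun y => flat n (Y y)) x u v =
      omega3 n (fderiv ℝ Y x (X x)) u v + omega3 n (Y x) (fderiv ℝ X x u) v
        + omega3 n (Y x) u (fderiv ℝ X x v) := by
  have h0 : F 0 = id := funext hF.init
  have hYd : HasFDerivAt Y (fderiv ℝ Y x) (F 0 x) := by
    rw [hF.init]
    exact (hY.differentiable (by simp) x).hasFDerivAt
  have hc : HasDerivAt (fun t => Y (F t x)) (fderiv ℝ Y x (X (F 0 x))) 0 :=
    hYd.comp_hasDerivAt (0 : ℝ) (hF.deriv 0 x)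
  have := (np_omega3_hasDerivAt n hc (np_flow_deriv n hF x u) (np_flow_deriv n hF x v)).deriv
  unfold lieDeriv2 flat
  rw [this]
  simp [h0]

theorem np_omega3_fderiv (n : ℕ) {X Y : V n → V n} (hX : ContDiff ℝ (⊤ : ℕ∞) X)
    (hY : ContDiff ℝ (⊤ : ℕ∞) Y) (x u w : V n) :
    fderiv ℝ (fun y => omega3 n (Y y) (X y) w) x u =
      omega3 n (fderiv ℝ Y x u) (X x) w + omega3 n (Y x) (fderiv ℝ X x u) w := by
  have hXd := hX.differentiable (by simp)
  have hYd := hY.differentiable (by simp)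
  have hXi := differentiable_pi.1 hXd
  have hYi := differentiable_pi.1 hYd
  have hd : Differentiable ℝ (fun y => omega3 n (Y y) (X y) w) := by
    unfold omega3
    simp only [Matrix.det_fin_three, Matrix.of_apply, Matrix.cons_val]
    fun_prop
  rw [← (hd x).lineDeriv_eq_fderiv]
  have hx := (hXd x).hasFDerivAt.hasLineDerivAt u
  have hy := (hYd x).hasFDerivAt.hasLineDerivAt u
  have := np_omega3_hasDerivAt n hy hx (hasDerivAt_const (0 : ℝ) w)
  unfold lineDeriv
  rw [this.deriv]
  simp [omega3, Matrix.det_fin_three]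

/-- For smooth 2-form fields `α, β` on `ℝ^{3n}` with complete associated
vector fields, the Nambu–Poisson bracket satisfies
`{α, β} = L_{α^♯}((β^♯)^♭) - L_{β^♯}((α^♯)^♭) - d(i_{α^♯} i_{β^♯} ω)`. -/
theorem npBracket_formula (n : ℕ)
    (α β : V n → V n → V n → ℝ)
    (hα : IsSmooth2FormField n α) (hβ : IsSmooth2FormField n β)
    (Fα Fβ : ℝ → V n → V n)
    (hFα : IsFlow n (sharpField n α) Fα) (hFβ : IsFlow n (sharpField n β) Fβ) :
    ∀ x u v : V n,
      npBracket n α β x u v =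
        lieDeriv2 n Fα (fun y => flat n (sharpField n β y)) x u v -
          lieDeriv2 n Fβ (fun y => flat n (sharpField n α y)) x u v -
          extDeriv1 n (fun y w => omega3 n (sharpField n β y) (sharpField n α y) w) x u v := by
  intro x u v
  have hX := np_sharp_smooth n hα
  have hY := np_sharp_smooth n hβ
  rw [np_lieDeriv2 n hFα hY, np_lieDeriv2 n hFβ hX]
  unfold npBracket lieBracketVF extDeriv1
  rw [np_omega3_fderiv n hX hY, np_omega3_fderiv n hX hY]
  unfold omega3
  simp only [← Finset.sum_add_distrib, ← Finset.sum_sub_distrib]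
  refine Finset.sum_congr rfl fun i _ => ?_
  simp only [Matrix.det_fin_three, Matrix.of_apply, Matrix.cons_val, Pi.sub_apply]
  ring
end
end

section
/- Let f, g, h, g', h' : ℝ^{3n} → ℝ be smooth functions such that (dh ∧ dg) ∼ (dh' ∧ dg') and (df ∧ dg')^{♯♭} = df ∧ dg' pointwise. Then {f, g, h} · dg' = i_{(dg ∧ dh)^♯} i_{(df ∧ dg')^♯} ω as 1-form fields; explicitly, for every x ∈ ℝ^{3n} and every vector v, {f, g, h}(x) · dg'_x(v) = ω((df ∧ dg')^♯(x), (dg ∧ dh)^♯(x), v). -/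
noncomputable section

/-- The 2-form field `df ∧ dg` of two functions `f, g : ℝ^{3n} → ℝ`. -/
def wedge11 (n : ℕ) (f g : V n → ℝ) : V n → V n → V n → ℝ :=
  fun x u v => fderiv ℝ f x u * fderiv ℝ g x v - fderiv ℝ f x v * fderiv ℝ g x u

/-- The Nambu bracket of three functions: `{f, g, h} = df((dg ∧ dh)^♯)`. -/
def nambuBracket3 (n : ℕ) (f g h : V n → ℝ) : V n → ℝ :=
  fun x => fderiv ℝ f x (sharpField n (wedge11 n g h) x)

theorem eps_antisymm_aux (a b : Fin 3 → ℝ) :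
    ∑ p : Fin 3, ((1 / 2) * ∑ l : Fin 3, ∑ m : Fin 3,
      eps p l m * (a l * b m - a m * b l)) * b p = 0 := by
  simp [Fin.sum_univ_three, eps, Matrix.det_fin_three, Pi.single_apply]
  ring

theorem fderiv_sharp_aux (n : ℕ) (L M : V n →L[ℝ] ℝ) :
    M (sharp n (fun u v => L u * M v - L v * M u)) = 0 := by
  have key : ∀ w : V n, M w = ∑ i : Fin n, ∑ p : Fin 3, w (i, p) * M (stdVec n i p) := by
    intro w
    conv_lhs => rw [← Finset.univ_sum_single w]
    rw [map_sum, Fintype.sum_prod_type]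
    refine Finset.sum_congr rfl fun i _ => Finset.sum_congr rfl fun p _ => ?_
    have : (Pi.single (i, p) (w (i, p)) : V n) = w (i, p) • stdVec n i p := by
      unfold stdVec
      rw [← Pi.single_smul]; simp
    rw [this, map_smul, smul_eq_mul]
  rw [key]
  refine Finset.sum_eq_zero fun i _ => ?_
  exact eps_antisymm_aux (fun p => L (stdVec n i p)) (fun p => M (stdVec n i p))

theorem sharp_swap_aux (n : ℕ) (g h : V n → ℝ) (x : V n) :
    sharpField n (wedge11 n g h) x = - sharpField n (wedge11 n h g) x := by
  funext q
  simp only [sharpField, sharp, wedge11, Pi.neg_apply]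
  rw [← mul_neg, ← Finset.sum_neg_distrib]
  congr 1
  refine Finset.sum_congr rfl fun l _ => ?_
  rw [← Finset.sum_neg_distrib]
  refine Finset.sum_congr rfl fun m _ => ?_
  ring

/-- Let `f, g, h, g', h'` be smooth functions on `ℝ^{3n}` with
`(dh ∧ dg) ∼ (dh' ∧ dg')` and `(df ∧ dg')^{♯♭} = df ∧ dg'`. Then
`{f, g, h} · dg' = i_{(dg ∧ dh)^♯} i_{(df ∧ dg')^♯} ω` as 1-form fields. -/
theorem nambuBracket3_contraction (n : ℕ)
    (f g h g' h' : V n → ℝ)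
    (hf : ContDiff ℝ (⊤ : ℕ∞) f) (hg : ContDiff ℝ (⊤ : ℕ∞) g) (hh : ContDiff ℝ (⊤ : ℕ∞) h)
    (hg' : ContDiff ℝ (⊤ : ℕ∞) g') (hh' : ContDiff ℝ (⊤ : ℕ∞) h')
    (hequiv : sharpField n (wedge11 n h g) = sharpField n (wedge11 n h' g'))
    (hdiag : ∀ x u v : V n,
      flat n (sharpField n (wedge11 n f g') x) u v = wedge11 n f g' x u v) :
    ∀ (x : V n) (v : V n),
      nambuBracket3 n f g h x * fderiv ℝ g' x v =
        omega3 n (sharpField n (wedge11 n f g') x) (sharpField n (wedge11 n g h) x) v := by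
  intro x v
  have h1 := hdiag x (sharpField n (wedge11 n g h) x) v
  have h2 : fderiv ℝ g' x (sharpField n (wedge11 n g h) x) = 0 := by
    rw [sharp_swap_aux, hequiv, map_neg, neg_eq_zero]
    exact fderiv_sharp_aux n (fderiv ℝ h' x) (fderiv ℝ g' x)
  simp only [flat] at h1
  rw [h1]
  simp only [wedge11, nambuBracket3] at h2 ⊢
  rw [h2]
  ring
end
end

section
/- For every alternating 2-form α on ℝ^{3n}, the contraction of the standard Nambu 3-form ω with the vector α^♯ equals the block diagonal part of α: ω(α^♯, u, v) = α^d(u, v) for all u, v ∈ ℝ^{3n}, where α^d = Σ_{i=0}^{n−1} Σ_{1 ≤ l < m ≤ 3} α_{3i+l, 3i+m} dx^{3i+l} ∧ dx^{3i+m}. In particular the coordinate definition of ♯ is coordinate free, being characterized by i_{α^♯} ω = α^d. -/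
noncomputable section

/-- `β` is an alternating (bilinear, antisymmetric) 2-form on `ℝ^{3n}`. -/
structure IsAlt2Form (n : ℕ) (β : V n → V n → ℝ) : Prop where
  add_left : ∀ u u' v : V n, β (u + u') v = β u v + β u' v
  smul_left : ∀ (c : ℝ) (u v : V n), β (c • u) v = c * β u v
  add_right : ∀ u v v' : V n, β u (v + v') = β u v + β u v'
  smul_right : ∀ (c : ℝ) (u v : V n), β u (c • v) = c * β u v
  alt : ∀ u : V n, β u u = 0

/-- For every alternating 2-form `α` on `ℝ^{3n}`, contracting the standard
Nambu 3-form with `α^♯` yields the block diagonal part of `α`: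
`ω(α^♯, u, v) = α^d(u, v)` where
`α^d = Σ_{i=0}^{n-1} Σ_{1 ≤ l < m ≤ 3} α_{3i+l, 3i+m} dx^{3i+l} ∧ dx^{3i+m}`.
In particular `♯` is characterized coordinate-freely by `i_{α^♯} ω = α^d`. -/
theorem flat_sharp_eq_block_diagonal (n : ℕ)
    (α : V n → V n → ℝ) (hα : IsAlt2Form n α) :
    ∀ u v : V n,
      omega3 n (sharp n α) u v =
        ∑ i : Fin n, ∑ l : Fin 3, ∑ m : Fin 3,
          (if l < m then
            α (stdVec n i l) (stdVec n i m) * (u (i, l) * v (i, m) - u (i, m) * v (i, l))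
          else 0) := by
  intro u v
  have anti : ∀ x y : V n, α y x = - α x y := by
    intro x y
    have h := hα.alt (x + y)
    rw [hα.add_left, hα.add_right, hα.add_right, hα.alt, hα.alt] at h
    linarith
  unfold omega3
  refine Finset.sum_congr rfl fun i _ => ?_
  have h10 := anti (stdVec n i 0) (stdVec n i 1)
  have h20 := anti (stdVec n i 0) (stdVec n i 2)
  have h21 := anti (stdVec n i 1) (stdVec n i 2)
  have s0 : sharp n α (i, 0) = α (stdVec n i 1) (stdVec n i 2) := by
    simp [sharp, eps, Fin.sum_univ_three, Matrix.det_fin_three, Pi.single_apply, h10, h20, h21]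
    try ring
  have s1 : sharp n α (i, 1) = - α (stdVec n i 0) (stdVec n i 2) := by
    simp [sharp, eps, Fin.sum_univ_three, Matrix.det_fin_three, Pi.single_apply, h10, h20, h21]
    try ring
  have s2 : sharp n α (i, 2) = α (stdVec n i 0) (stdVec n i 1) := by
    simp [sharp, eps, Fin.sum_univ_three, Matrix.det_fin_three, Pi.single_apply, h10, h20, h21]
    try ring
  simp [Fin.sum_univ_three, Matrix.det_fin_three, s0, s1, s2]
  try ring
end
end

section
/- Consider ℝ⁶ with coordinates (x₁, y₁, z₁, x₂, y₂, z₂) and the standard Nambu 3-form ω = dx₁ ∧ dy₁ ∧ dz₁ + dx₂ ∧ dy₂ ∧ dz₂. Let I_{x₁} = I_{y₁} > 0, I_{z₁} > 0, I_{x₂} = I_{y₂} > 0, I_{z₂} > 0 and C₃ ∈ ℝ, and define the Nambu functions H₁ = ½(x₁² + y₁² + z₁²) + ½(x₂² + y₂² + z₂²) and H₂ = ½(x₁²/I_{x₁} + y₁²/I_{y₁} + z₁²/I_{z₁}) + ½(x₂²/I_{x₂} + y₂²/I_{y₂} + z₂²/I_{z₂}) + C₃ z₁ z₂. Then the equations of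 motion of the coupled symmetric tops have generalized Nambu form: the Nambu vector field N = (dH₁ ∧ dH₂)^♯ has components N_{x₁} = y₁ z₁ (1/I_{z₁} − 1/I_{y₁}) + C₃ y₁ z₂, N_{y₁} = x₁ z₁ (1/I_{x₁} − 1/I_{z₁}) − C₃ x₁ z₂, N_{z₁} = 0, N_{x₂} = y₂ z₂ (1/I_{z₂} − 1/I_{y₂}) + C₃ y₂ z₁, N_{y₂} = x₂ z₂ (1/I_{x₂} − 1/I_{z₂}) − C₃ x₂ z₁, N_{z₂} = 0; in particular z₁ and z₂ are conserved and the coupling only adds an effective torque proportional to the other body's third angular momentum component. -/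
noncomputable section

/-- The Nambu vector field `N = (dH₁ ∧ dH₂)^♯` of two Nambu functions `H₁, H₂`, with
components `N_{3i+p}(x) = Σ_{l,m} ε_{plm} (∂H₁/∂x_{3i+l})(x) (∂H₂/∂x_{3i+m})(x)`. -/
def nambuVF (n : ℕ) (H₁ H₂ : V n → ℝ) : V n → V n :=
  fun x q => ∑ l : Fin 3, ∑ m : Fin 3,
    eps q.2 l m * fderiv ℝ H₁ x (stdVec n q.1 l) * fderiv ℝ H₂ x (stdVec n q.1 m)

theorem aux_coord (x : V 2) (q : Fin 2 × Fin 3) :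
    HasFDerivAt (fun y : V 2 => y q) (ContinuousLinearMap.proj (R := ℝ) (φ := fun _ : Fin 2 × Fin 3 => ℝ) q) x :=
  hasFDerivAt_apply q x

theorem aux_H (a b c d e f C : ℝ) (x v : V 2) :
    fderiv ℝ (fun x : V 2 =>
      (1 / 2) * (x (0, 0) ^ 2 / a + x (0, 1) ^ 2 / b + x (0, 2) ^ 2 / c) +
        (1 / 2) * (x (1, 0) ^ 2 / d + x (1, 1) ^ 2 / e + x (1, 2) ^ 2 / f) +
        C * (x (0, 2) * x (1, 2))) x v =
      x (0, 0) * v (0, 0) / a + x (0, 1) * v (0, 1) / b + x (0, 2) * v (0, 2) / c +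
      x (1, 0) * v (1, 0) / d + x (1, 1) * v (1, 1) / e + x (1, 2) * v (1, 2) / f +
      C * (x (0, 2) * v (1, 2) + x (1, 2) * v (0, 2)) := by
  have h := fun q => aux_coord x q
  have sq := fun (q : Fin 2 × Fin 3) (k : ℝ) => ((h q).pow 2).mul_const k⁻¹
  have H := ((((sq (0, 0) a).add (sq (0, 1) b)).add (sq (0, 2) c)).const_mul (1 / 2 : ℝ)).add
    ((((sq (1, 0) d).add (sq (1, 1) e)).add (sq (1, 2) f)).const_mul (1 / 2 : ℝ)) |>.add
    (((h (0, 2)).mul (h (1, 2))).const_mul C)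
  simp only [div_eq_mul_inv] at H ⊢
  erw [H.fderiv]
  simp
  ring

/-- On `ℝ⁶` (blocks `(x₁,y₁,z₁) = (x (0,0), x (0,1), x (0,2))` and
`(x₂,y₂,z₂) = (x (1,0), x (1,1), x (1,2))`) with the standard Nambu 3-form, the equations of
motion of two coupled symmetric tops (`I_{x₁} = I_{y₁} > 0`, `I_{x₂} = I_{y₂} > 0`, coupling
`C₃ z₁ z₂`) have generalized Nambu form: the Nambu vector field `N = (dH₁ ∧ dH₂)^♯` of the
Nambu functions `H₁, H₂` has the stated components; in particular `z₁, z₂` are conserved. -/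
theorem coupled_rigid_bodies
    (Ix₁ Iy₁ Iz₁ Ix₂ Iy₂ Iz₂ C₃ : ℝ)
    (hxy₁ : Ix₁ = Iy₁) (hxy₂ : Ix₂ = Iy₂)
    (hIx₁ : 0 < Ix₁) (hIy₁ : 0 < Iy₁) (hIz₁ : 0 < Iz₁)
    (hIx₂ : 0 < Ix₂) (hIy₂ : 0 < Iy₂) (hIz₂ : 0 < Iz₂)
    (H₁ H₂ : V 2 → ℝ)
    (hH₁ : H₁ = fun x =>
      (1 / 2) * (x (0, 0) ^ 2 + x (0, 1) ^ 2 + x (0, 2) ^ 2) +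
        (1 / 2) * (x (1, 0) ^ 2 + x (1, 1) ^ 2 + x (1, 2) ^ 2))
    (hH₂ : H₂ = fun x =>
      (1 / 2) * (x (0, 0) ^ 2 / Ix₁ + x (0, 1) ^ 2 / Iy₁ + x (0, 2) ^ 2 / Iz₁) +
        (1 / 2) * (x (1, 0) ^ 2 / Ix₂ + x (1, 1) ^ 2 / Iy₂ + x (1, 2) ^ 2 / Iz₂) +
        C₃ * (x (0, 2) * x (1, 2))) :
    ∀ x : V 2,
      nambuVF 2 H₁ H₂ x (0, 0) =
          x (0, 1) * x (0, 2) * (1 / Iz₁ - 1 / Iy₁) + C₃ * (x (0, 1) * x (1, 2)) ∧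
      nambuVF 2 H₁ H₂ x (0, 1) =
          x (0, 0) * x (0, 2) * (1 / Ix₁ - 1 / Iz₁) - C₃ * (x (0, 0) * x (1, 2)) ∧
      nambuVF 2 H₁ H₂ x (0, 2) = 0 ∧
      nambuVF 2 H₁ H₂ x (1, 0) =
          x (1, 1) * x (1, 2) * (1 / Iz₂ - 1 / Iy₂) + C₃ * (x (1, 1) * x (0, 2)) ∧
      nambuVF 2 H₁ H₂ x (1, 1) =
          x (1, 0) * x (1, 2) * (1 / Ix₂ - 1 / Iz₂) - C₃ * (x (1, 0) * x (0, 2)) ∧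
      nambuVF 2 H₁ H₂ x (1, 2) = 0 := by
  intro x
  have h1 : H₁ = fun x : V 2 =>
      (1 / 2) * (x (0, 0) ^ 2 / 1 + x (0, 1) ^ 2 / 1 + x (0, 2) ^ 2 / 1) +
        (1 / 2) * (x (1, 0) ^ 2 / 1 + x (1, 1) ^ 2 / 1 + x (1, 2) ^ 2 / 1) +
        0 * (x (0, 2) * x (1, 2)) := by
    rw [hH₁]; funext x; ring
  have d1 := fun v => aux_H 1 1 1 1 1 1 0 x v
  have d2 := fun v => aux_H Ix₁ Iy₁ Iz₁ Ix₂ Iy₂ Iz₂ C₃ x v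
  simp only [← h1] at d1
  simp only [← hH₂] at d2
  clear h1 hH₁ hH₂
  subst hxy₁ hxy₂
  refine ⟨?_, ?_, ?_, ?_, ?_, ?_⟩ <;>
  · simp [nambuVF, d1, d2, Fin.sum_univ_three, eps, Matrix.det_fin_three, stdVec, Pi.single_apply]
    try ring
end
end
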